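/- Let H, u : B_R → ℝ² be smooth with compact support (or vanishing on ∂B_R), and let H_t, Φ be defined via the induction equation H_t = νΔH + H·∇u − u·∇H − H div u with ν > 0 and div H = 0. Then ‖H_t‖_{L²}² ≤ C(‖∇²H‖_{L²}² + ‖u x̄^{-a/2}‖_{L^∞}² ‖∇H x̄^{a/2}‖_{L²}² + ‖H‖_{L²}‖H‖_{H¹}‖∇u‖_{L²}‖∇u‖_{H¹}), where C depends only on ν and the Gagliardo–Nirenberg constants. -/

import Mathlib

open MeasureTheory Real

abbrev E2 := EuclideanSpace ℝ (Fin 2)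

noncomputable def xbar (η₀ : ℝ) (x : E2) : ℝ :=
  (Real.exp 1 + ‖x‖ ^ 2) ^ ((1 : ℝ) / 2) * Real.log (Real.exp 1 + ‖x‖ ^ 2) ^ (1 + η₀)

noncomputable def pd (i : Fin 2) (f : E2 → ℝ) (x : E2) : ℝ :=
  fderiv ℝ f x (EuclideanSpace.single i (1 : ℝ))

noncomputable def divg (v : E2 → E2) (x : E2) : ℝ :=
  ∑ i : Fin 2, pd i (fun y => v y i) x

noncomputable def gradsq (v : E2 → E2) (x : E2) : ℝ :=
  ∑ i : Fin 2, ∑ j : Fin 2, (pd i (fun y => v y j) x) ^ 2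

noncomputable def lapc (f : E2 → ℝ) (x : E2) : ℝ :=
  ∑ i : Fin 2, iteratedFDeriv ℝ 2 f x (fun _ => EuclideanSpace.single i (1 : ℝ))

section helpers

open Set

lemma integrableOn_ball_of_continuous {f : E2 → ℝ} (hf : Continuous f) (R : ℝ) :
    IntegrableOn f (Metric.ball (0 : E2) R) :=
  (hf.continuousOn.integrableOn_compact (isCompact_closedBall (0 : E2) R)).mono_set
    Metric.ball_subset_closedBall

lemma contDiff_pd {f : E2 → ℝ} (hf : ContDiff ℝ (⊤ : ℕ∞) f) (i : Fin 2) :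
    ContDiff ℝ (⊤ : ℕ∞) (pd i f) :=
  (hf.fderiv_right (m := (⊤ : ℕ∞)) (by norm_cast)).clm_apply contDiff_const

lemma sq_le_integral_of_eq_zero {f f' : ℝ → ℝ} (hf : ∀ t, HasDerivAt f (f' t) t)
    (hf' : Continuous f') {c z t : ℝ} (hz : z ∈ Icc (-c) c) (ht : t ∈ Icc (-c) c)
    (hfz : f z = 0) :
    f t ^ 2 ≤ ∫ s in Ioo (-c) c, 2 * |f s * f' s| := by
  have hfc : Continuous f := continuous_iff_continuousAt.2 fun s => (hf s).continuousAt
  have hg : ∀ s, HasDerivAt (fun s => f s ^ 2) (2 * (f s * f' s)) s := fun s => by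
    simpa [mul_assoc] using (hf s).fun_pow 2
  have hcont : Continuous fun s => 2 * (f s * f' s) := by fun_prop
  have h := intervalIntegral.integral_eq_sub_of_hasDerivAt (a := z) (b := t)
    (fun s _ => hg s) (hcont.intervalIntegrable _ _)
  have hsub : uIoc z t ⊆ Ioc (-c) c := by
    intro s hs
    rw [mem_uIoc] at hs
    rcases hs with hs | hs
    · exact ⟨hz.1.trans_lt hs.1, hs.2.trans ht.2⟩
    · exact ⟨ht.1.trans_lt hs.1, hs.2.trans hz.2⟩
  have hcont' : Continuous fun s => 2 * |f s * f' s| := by fun_prop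
  calc f t ^ 2 = ∫ s in z..t, 2 * (f s * f' s) := by rw [h, hfz]; ring
    _ ≤ ‖∫ s in z..t, 2 * (f s * f' s)‖ := le_abs_self _
    _ ≤ ∫ s in uIoc z t, ‖2 * (f s * f' s)‖ := intervalIntegral.norm_integral_le_integral_norm_uIoc
    _ = ∫ s in uIoc z t, 2 * |f s * f' s| := by simp [abs_mul]
    _ ≤ ∫ s in Ioc (-c) c, 2 * |f s * f' s| := by
        refine setIntegral_mono_set ?_ ?_ hsub.eventuallyLE
        · exact (hcont'.continuousOn.integrableOn_compact isCompact_Icc).mono_set Ioc_subset_Icc_self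
        · exact Filter.Eventually.of_forall fun s => by positivity
    _ = ∫ s in Ioo (-c) c, 2 * |f s * f' s| := integral_Ioc_eq_integral_Ioo

lemma ofReal_sq_le_lintegral_of_eq_zero {f f' : ℝ → ℝ} (hf : ∀ t, HasDerivAt f (f' t) t)
    (hf' : Continuous f') {c z t : ℝ} (hz : z ∈ Icc (-c) c) (ht : t ∈ Icc (-c) c)
    (hfz : f z = 0) :
    ENNReal.ofReal (f t ^ 2) ≤ ∫⁻ s in Ioo (-c) c, ENNReal.ofReal (2 * |f s * f' s|) := by
  have hfc : Continuous f := continuous_iff_continuousAt.2 fun s => (hf s).continuousAt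
  have hcont' : Continuous fun s => 2 * |f s * f' s| := by fun_prop
  rw [← ofReal_integral_eq_lintegral_ofReal]
  · exact ENNReal.ofReal_le_ofReal (sq_le_integral_of_eq_zero hf hf' hz ht hfz)
  · exact (hcont'.continuousOn.integrableOn_compact isCompact_Icc).mono_set Ioo_subset_Icc_self
  · exact Filter.Eventually.of_forall fun s => by positivity

lemma lintegral_mul_le_of_le_lintegral_slices {φ ψ a b : ℝ × ℝ → ENNReal}
    (hφ : Measurable φ) (hψ : Measurable ψ) (ha : Measurable a) (hb : Measurable b)
    (hφa : ∀ x y, φ (x, y) ≤ ∫⁻ s, a (s, y)) (hψb : ∀ x y, ψ (x, y) ≤ ∫⁻ t, b (x, t)) :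
    ∫⁻ p, φ p * ψ p ≤ (∫⁻ p, a p) * ∫⁻ p, b p := by
  have hA : Measurable fun y => ∫⁻ s, a (s, y) := ha.lintegral_prod_left'
  have hB : Measurable fun x => ∫⁻ t, b (x, t) := hb.lintegral_prod_right'
  rw [Measure.volume_eq_prod, lintegral_prod (fun p => φ p * ψ p) (hφ.mul hψ).aemeasurable,
    lintegral_prod_symm _ ha.aemeasurable, lintegral_prod _ hb.aemeasurable]
  calc ∫⁻ x, ∫⁻ y, φ (x, y) * ψ (x, y)
      ≤ ∫⁻ x, ∫⁻ y, (∫⁻ s, a (s, y)) * ∫⁻ t, b (x, t) :=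
        lintegral_mono fun x => lintegral_mono fun y => mul_le_mul' (hφa x y) (hψb x y)
    _ = ∫⁻ x, (∫⁻ y, ∫⁻ s, a (s, y)) * ∫⁻ t, b (x, t) :=
        lintegral_congr fun x => lintegral_mul_const _ hA
    _ = _ := lintegral_const_mul _ hB

/-- The point of the plane with `i`-th coordinate `p.1` and `k`-th coordinate `p.2`. -/
noncomputable def planePoint (i k : Fin 2) (p : ℝ × ℝ) : E2 :=
  p.1 • EuclideanSpace.single i (1 : ℝ) + p.2 • EuclideanSpace.single k (1 : ℝ)

lemma measurePreserving_planePoint {i k : Fin 2} (hik : i ≠ k) :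
    MeasurePreserving (planePoint i k) := by
  have h01 : MeasurePreserving (planePoint 0 1) := by
    have h := (PiLp.volume_preserving_toLp (Fin 2)).comp
      ((volume_preserving_finTwoArrow ℝ).symm _)
    have heq : planePoint 0 1
        = WithLp.toLp 2 ∘ (MeasurableEquiv.finTwoArrow : (Fin 2 → ℝ) ≃ᵐ ℝ × ℝ).symm := by
      funext p
      ext j
      fin_cases j <;> simp [planePoint, MeasurableEquiv.finTwoArrow]
    exact heq ▸ h
  have h10 : MeasurePreserving (planePoint 1 0) := by
    have h := h01.comp (Measure.measurePreserving_swap (μ := (volume : Measure ℝ)) (ν := volume))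
    have heq : planePoint 1 0 = planePoint 0 1 ∘ Prod.swap := by
      funext p
      simp [planePoint, add_comm]
    exact heq ▸ h
  fin_cases i <;> fin_cases k
  · simp at hik
  · exact h01
  · exact h10
  · simp at hik

lemma norm_sq_planePoint {i k : Fin 2} (hik : i ≠ k) (p : ℝ × ℝ) :
    ‖planePoint i k p‖ ^ 2 = p.1 ^ 2 + p.2 ^ 2 := by
  rw [EuclideanSpace.norm_sq_eq]
  fin_cases i <;> fin_cases k <;> simp_all [planePoint, add_comm]

lemma continuous_planePoint (i k : Fin 2) : Continuous (planePoint i k) := by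
  unfold planePoint; fun_prop

lemma mem_ball_planePoint {i k : Fin 2} (hik : i ≠ k) {R : ℝ} (hR : 0 < R) (p : ℝ × ℝ) :
    planePoint i k p ∈ Metric.ball (0 : E2) R ↔ p.1 ^ 2 + p.2 ^ 2 < R ^ 2 := by
  rw [mem_ball_zero_iff, ← norm_sq_planePoint hik, sq_lt_sq₀ (norm_nonneg _) hR.le]

lemma mem_sphere_planePoint {i k : Fin 2} (hik : i ≠ k) {R : ℝ} (hR : 0 < R) {p : ℝ × ℝ}
    (h : p.1 ^ 2 + p.2 ^ 2 = R ^ 2) : planePoint i k p ∈ Metric.sphere (0 : E2) R := by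
  rw [mem_sphere_zero_iff_norm, ← sq_eq_sq₀ (norm_nonneg _) hR.le, norm_sq_planePoint hik, h]

lemma hasDerivAt_planePoint_left {f : E2 → ℝ} (hf : Differentiable ℝ f) (i k : Fin 2)
    (s t : ℝ) :
    HasDerivAt (fun s => f (planePoint i k (s, t))) (pd i f (planePoint i k (s, t))) s := by
  have h : HasDerivAt (fun s => planePoint i k (s, t)) (EuclideanSpace.single i (1 : ℝ)) s := by
    simpa [planePoint] using ((hasDerivAt_id s).smul_const (EuclideanSpace.single i (1 : ℝ))).add_const
      (t • EuclideanSpace.single k (1 : ℝ))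
  exact (hf (planePoint i k (s, t))).hasFDerivAt.comp_hasDerivAt s h

lemma planePoint_swap (i k : Fin 2) (s t : ℝ) : planePoint i k (s, t) = planePoint k i (t, s) :=
  add_comm _ _

/-- A function with a zero on each chord of the disc in direction `i` is controlled by the
integrals over these chords. -/
lemma indicator_sq_le_lintegral_chord {i k : Fin 2} (hik : i ≠ k) {R : ℝ} (hR : 0 < R)
    {f : E2 → ℝ} (hf : ContDiff ℝ (⊤ : ℕ∞) f)
    (hz : ∀ c t : ℝ, 0 < c → c ^ 2 + t ^ 2 = R ^ 2 →
      ∃ z ∈ Icc (-c) c, f (planePoint i k (z, t)) = 0) (s t : ℝ) :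
    (Metric.ball (0 : E2) R).indicator (fun x => ENNReal.ofReal (f x ^ 2)) (planePoint i k (s, t))
      ≤ ∫⁻ r, (Metric.ball (0 : E2) R).indicator
          (fun x => ENNReal.ofReal (2 * |f x * pd i f x|)) (planePoint i k (r, t)) := by
  by_cases hmem : planePoint i k (s, t) ∈ Metric.ball (0 : E2) R
  swap
  · simp [hmem]
  have hst := (mem_ball_planePoint hik hR _).1 hmem
  simp only at hst
  have hpos : 0 < R ^ 2 - t ^ 2 := by nlinarith [sq_nonneg s]
  obtain ⟨c, hc, hcR⟩ : ∃ c : ℝ, 0 < c ∧ c ^ 2 + t ^ 2 = R ^ 2 :=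
    ⟨√(R ^ 2 - t ^ 2), Real.sqrt_pos.2 hpos, by rw [Real.sq_sqrt hpos.le]; ring⟩
  have hchord : ∀ r, planePoint i k (r, t) ∈ Metric.ball (0 : E2) R ↔ r ∈ Ioo (-c) c := by
    intro r
    rw [mem_ball_planePoint hik hR, mem_Ioo, ← abs_lt, ← sq_lt_sq₀ (abs_nonneg r) hc.le, sq_abs]
    simp only
    constructor <;> intro <;> linarith
  obtain ⟨z, hzc, hfz⟩ := hz c t hc hcR
  have hline : Continuous fun r : ℝ => planePoint i k (r, t) :=
    (continuous_planePoint i k).comp (by fun_prop)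
  have hmain := ofReal_sq_le_lintegral_of_eq_zero
    (fun r => hasDerivAt_planePoint_left (hf.differentiable (by simp)) i k r t)
    ((contDiff_pd hf i).continuous.comp hline) hzc (Ioo_subset_Icc_self ((hchord s).1 hmem)) hfz
  rw [indicator_of_mem hmem]
  refine hmain.trans_eq ?_
  rw [← lintegral_indicator measurableSet_Ioo]
  refine lintegral_congr fun r => ?_
  simp only [indicator, hchord]

lemma lintegral_ball_eq {i k : Fin 2} (hik : i ≠ k) (R : ℝ) {g : E2 → ENNReal}
    (hg : Measurable g) :
    ∫⁻ x in Metric.ball (0 : E2) R, g x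
      = ∫⁻ p, (Metric.ball (0 : E2) R).indicator g (planePoint i k p) := by
  rw [← lintegral_indicator Metric.isOpen_ball.measurableSet]
  exact ((measurePreserving_planePoint hik).lintegral_comp
    (hg.indicator Metric.isOpen_ball.measurableSet)).symm

lemma integral_ball_mul_sq_pd_le {i k : Fin 2} (hik : i ≠ k) {R : ℝ} (hR : 0 < R)
    {f g : E2 → ℝ} (hf : ContDiff ℝ (⊤ : ℕ∞) f) (hg : ContDiff ℝ (⊤ : ℕ∞) g)
    (hf0 : ∀ x ∈ Metric.sphere (0 : E2) R, f x = 0)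
    (hg0 : ∀ x ∈ Metric.sphere (0 : E2) R, g x = 0) :
    ∫ x in Metric.ball (0 : E2) R, f x ^ 2 * pd k g x ^ 2
      ≤ (∫ x in Metric.ball (0 : E2) R, 2 * |f x * pd i f x|)
        * ∫ x in Metric.ball (0 : E2) R, 2 * |pd k g x * pd k (pd k g) x| := by
  have cf := hf.continuous
  have cfi := (contDiff_pd hf i).continuous
  have cg := (contDiff_pd hg k).continuous
  have cgk := (contDiff_pd (contDiff_pd hg k) k).continuous
  have hM := (continuous_planePoint i k).measurable
  have hmB : MeasurableSet (Metric.ball (0 : E2) R) := Metric.isOpen_ball.measurableSet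
  have c1 : Continuous fun x => f x ^ 2 * pd k g x ^ 2 := by fun_prop
  have c2 : Continuous fun x => 2 * |f x * pd i f x| := by fun_prop
  have c3 : Continuous fun x => 2 * |pd k g x * pd k (pd k g) x| := by fun_prop
  have m2 : Measurable fun x => ENNReal.ofReal (2 * |f x * pd i f x|) := c2.measurable.ennreal_ofReal
  have m3 : Measurable fun x => ENNReal.ofReal (2 * |pd k g x * pd k (pd k g) x|) :=
    c3.measurable.ennreal_ofReal
  have mf : Measurable fun x => f x ^ 2 := (by fun_prop : Continuous fun x => f x ^ 2).measurable
  have mg : Measurable fun x => pd k g x ^ 2 :=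
    (by fun_prop : Continuous fun x => pd k g x ^ 2).measurable
  have n2 : 0 ≤ ∫ x in Metric.ball (0 : E2) R, 2 * |f x * pd i f x| :=
    integral_nonneg fun x => by positivity
  have n3 : 0 ≤ ∫ x in Metric.ball (0 : E2) R, 2 * |pd k g x * pd k (pd k g) x| :=
    integral_nonneg fun x => by positivity
  rw [← ENNReal.ofReal_le_ofReal_iff (mul_nonneg n2 n3), ENNReal.ofReal_mul n2,
    ofReal_integral_eq_lintegral_ofReal (integrableOn_ball_of_continuous c1 R)
      (Filter.Eventually.of_forall fun x => by positivity),
    ofReal_integral_eq_lintegral_ofReal (integrableOn_ball_of_continuous c2 R)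
      (Filter.Eventually.of_forall fun x => by positivity),
    ofReal_integral_eq_lintegral_ofReal (integrableOn_ball_of_continuous c3 R)
      (Filter.Eventually.of_forall fun x => by positivity),
    lintegral_ball_eq hik R c1.measurable.ennreal_ofReal, lintegral_ball_eq hik R m2,
    lintegral_ball_eq hik R m3]
  refine le_trans (le_of_eq ?_) (lintegral_mul_le_of_le_lintegral_slices
    (φ := fun p => (Metric.ball (0 : E2) R).indicator
      (fun x => ENNReal.ofReal (f x ^ 2)) (planePoint i k p))
    (ψ := fun p => (Metric.ball (0 : E2) R).indicator
      (fun x => ENNReal.ofReal (pd k g x ^ 2)) (planePoint i k p))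
    ((mf.ennreal_ofReal.indicator hmB).comp hM)
    ((mg.ennreal_ofReal.indicator hmB).comp hM)
    ((m2.indicator hmB).comp hM) ((m3.indicator hmB).comp hM) ?_ ?_)
  · refine lintegral_congr fun p => ?_
    by_cases hp : planePoint i k p ∈ Metric.ball (0 : E2) R
    · simp only [indicator_of_mem hp]
      exact ENNReal.ofReal_mul (sq_nonneg _)
    · simp only [indicator_of_notMem hp, mul_zero]
  · refine indicator_sq_le_lintegral_chord hik hR hf fun c t hc hct => ?_
    exact ⟨c, ⟨by linarith, le_rfl⟩, hf0 _ (mem_sphere_planePoint hik hR hct)⟩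
  · intro s t
    simp only [planePoint_swap i k]
    refine indicator_sq_le_lintegral_chord hik.symm hR (contDiff_pd hg k)
      (fun c t hc hct => ?_) t s
    have hd := fun r => hasDerivAt_planePoint_left (hg.differentiable (by simp)) k i r t
    obtain ⟨z, hz, hz0⟩ := exists_hasDerivAt_eq_zero (a := -c) (b := c) (by linarith)
      (fun r _ => (hd r).continuousAt.continuousWithinAt)
      (by rw [hg0 _ (mem_sphere_planePoint hik.symm hR (by simpa using hct)),
        hg0 _ (mem_sphere_planePoint hik.symm hR hct)])
      (fun r _ => hd r)
    exact ⟨z, Ioo_subset_Icc_self hz, hz0⟩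

lemma integral_ball_abs_mul_le {f g : E2 → ℝ} (hf : Continuous f) (hg : Continuous g) (R : ℝ) :
    ∫ x in Metric.ball (0 : E2) R, |f x * g x|
      ≤ (∫ x in Metric.ball (0 : E2) R, f x ^ 2) ^ ((1 : ℝ) / 2)
        * (∫ x in Metric.ball (0 : E2) R, g x ^ 2) ^ ((1 : ℝ) / 2) := by
  have hL : ∀ {h : E2 → ℝ}, Continuous h →
      MemLp (fun x => |h x|) (ENNReal.ofReal 2) (volume.restrict (Metric.ball (0 : E2) R)) := by
    intro h hh
    rw [ENNReal.ofReal_ofNat, memLp_two_iff_integrable_sq hh.abs.aestronglyMeasurable]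
    exact integrableOn_ball_of_continuous (hh.abs.pow 2) R
  have h := integral_mul_le_Lp_mul_Lq_of_nonneg Real.HolderConjugate.two_two
    (Filter.Eventually.of_forall fun x => abs_nonneg (f x))
    (Filter.Eventually.of_forall fun x => abs_nonneg (g x)) (hL hf) (hL hg)
  simpa [abs_mul] using h

lemma contDiff_component {v : E2 → E2} (hv : ContDiff ℝ (⊤ : ℕ∞) v)
    (j : Fin 2) : ContDiff ℝ (⊤ : ℕ∞) fun y => v y j :=
  (EuclideanSpace.proj (𝕜 := ℝ) j).contDiff.comp hv

lemma continuous_pd_component {v : E2 → E2} (hv : ContDiff ℝ (⊤ : ℕ∞) v)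
    (i j : Fin 2) : Continuous (pd i fun y => v y j) :=
  (contDiff_pd (contDiff_component hv j) i).continuous

lemma continuous_gradsq {v : E2 → E2} (hv : ContDiff ℝ (⊤ : ℕ∞) v) : Continuous (gradsq v) := by
  have := continuous_pd_component hv
  unfold gradsq
  fun_prop

lemma continuous_norm_iteratedFDeriv_two {v : E2 → E2} (hv : ContDiff ℝ (⊤ : ℕ∞) v) :
    Continuous fun x => ‖iteratedFDeriv ℝ 2 v x‖ ^ 2 :=
  ((hv.continuous_iteratedFDeriv (m := 2) (WithTop.coe_le_coe.2 le_top)).norm).pow 2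

lemma norm_iteratedFDeriv_two_component_le {v : E2 → E2} (hv : ContDiff ℝ (⊤ : ℕ∞) v)
    (j : Fin 2) (x : E2) :
    ‖iteratedFDeriv ℝ 2 (fun y => v y j) x‖ ≤ ‖iteratedFDeriv ℝ 2 v x‖ := by
  have hp : ‖(EuclideanSpace.proj j : E2 →L[ℝ] ℝ)‖ ≤ 1 :=
    ContinuousLinearMap.opNorm_le_bound _ zero_le_one fun y => by
      simpa using PiLp.norm_apply_le y j
  refine ((EuclideanSpace.proj (𝕜 := ℝ) j).norm_iteratedFDeriv_comp_left hv.contDiffAt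
    (WithTop.coe_le_coe.2 le_top)).trans ?_
  exact mul_le_of_le_one_left (norm_nonneg _) hp

lemma abs_iteratedFDeriv_two_single_le {v : E2 → E2} (hv : ContDiff ℝ (⊤ : ℕ∞) v)
    (i j : Fin 2) (x : E2) :
    |iteratedFDeriv ℝ 2 (fun y => v y j) x (fun _ => EuclideanSpace.single i (1 : ℝ))|
      ≤ ‖iteratedFDeriv ℝ 2 v x‖ := by
  refine le_trans ?_ (norm_iteratedFDeriv_two_component_le hv j x)
  simpa using (iteratedFDeriv ℝ 2 (fun y => v y j) x).le_opNorm
    (fun _ => EuclideanSpace.single i (1 : ℝ))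

lemma pd_pd_component {v : E2 → E2} (hv : ContDiff ℝ (⊤ : ℕ∞) v) (i j : Fin 2) (x : E2) :
    pd i (pd i fun y => v y j) x
      = iteratedFDeriv ℝ 2 (fun y => v y j) x (fun _ => EuclideanSpace.single i (1 : ℝ)) := by
  have hd : DifferentiableAt ℝ (fderiv ℝ fun y => v y j) x :=
    (((contDiff_component hv j).fderiv_right (m := (⊤ : ℕ∞)) (by norm_cast)).differentiable
      (by simp)) x
  rw [iteratedFDeriv_two_apply]
  unfold pd
  rw [fderiv_clm_apply hd (differentiableAt_const _)]
  simp

lemma sq_component_le (y : E2) (j : Fin 2) : y j ^ 2 ≤ ‖y‖ ^ 2 := by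
  rw [EuclideanSpace.norm_sq_eq]
  fin_cases j <;> simp <;> positivity

lemma sq_pd_le_gradsq (v : E2 → E2) (i j : Fin 2) (x : E2) :
    pd i (fun y => v y j) x ^ 2 ≤ gradsq v x := by
  unfold gradsq
  fin_cases i <;> fin_cases j <;> simp [Fin.sum_univ_two] <;> nlinarith

lemma gradsq_nonneg (v : E2 → E2) (x : E2) : 0 ≤ gradsq v x := by
  unfold gradsq
  positivity

lemma integral_ball_sq_rpow_half_le {f g : E2 → ℝ} (hf : Continuous f) (hg : Continuous g) (R : ℝ)
    (h : ∀ x, f x ^ 2 ≤ g x) :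
    (∫ x in Metric.ball (0 : E2) R, f x ^ 2) ^ ((1 : ℝ) / 2)
      ≤ (∫ x in Metric.ball (0 : E2) R, g x) ^ ((1 : ℝ) / 2) := by
  refine Real.rpow_le_rpow (integral_nonneg fun x => sq_nonneg _) ?_ (by norm_num)
  exact integral_mono (integrableOn_ball_of_continuous (hf.pow 2) R)
    (integrableOn_ball_of_continuous hg R) h

/-- Product form of Ladyzhenskaya's inequality on a disc, for fields vanishing on its boundary. -/
lemma integral_ball_norm_sq_mul_gradsq_le {R : ℝ} (hR : 0 < R) {v w : E2 → E2}
    (hv : ContDiff ℝ (⊤ : ℕ∞) v) (hw : ContDiff ℝ (⊤ : ℕ∞) w)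
    (hv0 : ∀ x ∈ Metric.sphere (0 : E2) R, v x = 0)
    (hw0 : ∀ x ∈ Metric.sphere (0 : E2) R, w x = 0) :
    ∫ x in Metric.ball (0 : E2) R, ‖v x‖ ^ 2 * gradsq w x
      ≤ 32 * ((∫ x in Metric.ball (0 : E2) R, ‖v x‖ ^ 2) ^ ((1 : ℝ) / 2)
          * (∫ x in Metric.ball (0 : E2) R, gradsq v x) ^ ((1 : ℝ) / 2)
          * (∫ x in Metric.ball (0 : E2) R, gradsq w x) ^ ((1 : ℝ) / 2)
          * (∫ x in Metric.ball (0 : E2) R, ‖iteratedFDeriv ℝ 2 w x‖ ^ 2) ^ ((1 : ℝ) / 2)) := by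
  set X := (∫ x in Metric.ball (0 : E2) R, ‖v x‖ ^ 2) ^ ((1 : ℝ) / 2)
    * (∫ x in Metric.ball (0 : E2) R, gradsq v x) ^ ((1 : ℝ) / 2)
    * (∫ x in Metric.ball (0 : E2) R, gradsq w x) ^ ((1 : ℝ) / 2)
    * (∫ x in Metric.ball (0 : E2) R, ‖iteratedFDeriv ℝ 2 w x‖ ^ 2) ^ ((1 : ℝ) / 2) with hX
  have cv : ∀ l, Continuous fun x => v x l := fun l => (contDiff_component hv l).continuous
  have cw := continuous_pd_component hw
  have key : ∀ l k j : Fin 2,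
      ∫ x in Metric.ball (0 : E2) R, v x l ^ 2 * pd k (fun y => w y j) x ^ 2 ≤ 4 * X := by
    intro l k j
    obtain ⟨i, hik⟩ := exists_ne k
    have cvi := continuous_pd_component hv i l
    have cwkk := (contDiff_pd (contDiff_pd (contDiff_component hw j) k) k).continuous
    refine (integral_ball_mul_sq_pd_le hik hR (contDiff_component hv l) (contDiff_component hw j)
      (fun x hx => by simp [hv0 x hx]) (fun x hx => by simp [hw0 x hx])).trans ?_
    rw [integral_const_mul, integral_const_mul]
    have h1 := integral_ball_abs_mul_le (cv l) cvi R
    have h2 := integral_ball_abs_mul_le (cw k j) cwkk R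
    have b1 := integral_ball_sq_rpow_half_le (cv l) (g := fun x => ‖v x‖ ^ 2)
      (hv.continuous.norm.pow 2) R
      fun x => sq_component_le (v x) l
    have b2 := integral_ball_sq_rpow_half_le cvi (continuous_gradsq hv) R (sq_pd_le_gradsq v i l)
    have b3 := integral_ball_sq_rpow_half_le (cw k j) (continuous_gradsq hw) R
      (sq_pd_le_gradsq w k j)
    have b4 := integral_ball_sq_rpow_half_le cwkk (continuous_norm_iteratedFDeriv_two hw) R
      fun x => by
        rw [pd_pd_component hw, ← sq_abs]
        exact pow_le_pow_left₀ (abs_nonneg _) (abs_iteratedFDeriv_two_single_le hw k j x) 2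
    have nn : ∀ g : E2 → ℝ, (∀ x, 0 ≤ g x) →
        0 ≤ (∫ x in Metric.ball (0 : E2) R, g x) ^ ((1 : ℝ) / 2) := fun g hg =>
      Real.rpow_nonneg (integral_nonneg hg) _
    have h1' := h1.trans (mul_le_mul b1 b2 (nn _ fun x => sq_nonneg _)
      (nn _ fun x => sq_nonneg _))
    have h2' := h2.trans (mul_le_mul b3 b4 (nn _ fun x => sq_nonneg _)
      (nn _ fun x => gradsq_nonneg _ _))
    have h3 := mul_le_mul h1' h2' (integral_nonneg fun x => abs_nonneg _)
      (mul_nonneg (nn _ fun x => sq_nonneg _) (nn _ fun x => gradsq_nonneg _ _))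
    rw [hX]
    linarith
  have hterm : ∀ l k j : Fin 2, IntegrableOn
      (fun x => v x l ^ 2 * pd k (fun y => w y j) x ^ 2) (Metric.ball (0 : E2) R) := fun l k j =>
    integrableOn_ball_of_continuous (((cv l).pow 2).mul ((cw k j).pow 2)) R
  have hsum : ∀ x, ‖v x‖ ^ 2 * gradsq w x
      = ∑ l : Fin 2, ∑ k : Fin 2, ∑ j : Fin 2, v x l ^ 2 * pd k (fun y => w y j) x ^ 2 := by
    intro x
    simp only [EuclideanSpace.norm_sq_eq, gradsq, Fin.sum_univ_two,
      Real.norm_eq_abs, sq_abs]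
    ring
  simp only [hsum]
  rw [integral_finsetSum _ fun l _ => integrable_finsetSum _ fun k _ =>
    integrable_finsetSum _ fun j _ => hterm l k j]
  calc _ = ∑ l : Fin 2, ∑ k : Fin 2, ∑ j : Fin 2,
        ∫ x in Metric.ball (0 : E2) R, v x l ^ 2 * pd k (fun y => w y j) x ^ 2 := by
        refine Finset.sum_congr rfl fun l _ => ?_
        rw [integral_finsetSum _ fun k _ => integrable_finsetSum _ fun j _ => hterm l k j]
        exact Finset.sum_congr rfl fun k _ => integral_finsetSum _ fun j _ => hterm l k j
    _ ≤ ∑ _l : Fin 2, ∑ _k : Fin 2, ∑ _j : Fin 2, 4 * X :=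
        Finset.sum_le_sum fun l _ => Finset.sum_le_sum fun k _ => Finset.sum_le_sum fun j _ =>
          key l k j
    _ = 32 * X := by simp; ring

lemma xbar_pos (η₀ : ℝ) (x : E2) : 0 < xbar η₀ x := by
  have h : 1 < Real.exp 1 + ‖x‖ ^ 2 := by
    nlinarith [Real.add_one_lt_exp (one_ne_zero (α := ℝ)), sq_nonneg ‖x‖]
  exact mul_pos (Real.rpow_pos_of_pos (by linarith) _) (Real.rpow_pos_of_pos (Real.log_pos h) _)

lemma continuous_xbar (η₀ : ℝ) : Continuous (xbar η₀) := by
  have h : ∀ x : E2, 1 < Real.exp 1 + ‖x‖ ^ 2 := fun x => by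
    nlinarith [Real.add_one_lt_exp (one_ne_zero (α := ℝ)), sq_nonneg ‖x‖]
  have hc : Continuous fun x : E2 => Real.exp 1 + ‖x‖ ^ 2 := by fun_prop
  exact (hc.rpow_const fun x => Or.inl (by linarith [h x])).mul
    ((hc.log fun x => by linarith [h x]).rpow_const fun x => Or.inl (Real.log_pos (h x)).ne')

lemma continuous_xbar_rpow (η₀ b : ℝ) : Continuous fun x => xbar η₀ x ^ b :=
  (continuous_xbar η₀).rpow_const fun x => Or.inl (xbar_pos η₀ x).ne'

lemma integral_ball_norm_sq_mul_le_weighted (a η₀ R : ℝ) {u : E2 → E2} (hu : Continuous u)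
    {g : E2 → ℝ} (hg : Continuous g) (hg0 : ∀ x, 0 ≤ g x) :
    ∫ x in Metric.ball (0 : E2) R, ‖u x‖ ^ 2 * g x
      ≤ ((eLpNorm (fun x => ‖u x‖ * xbar η₀ x ^ (-(a / 2))) ⊤
          (volume.restrict (Metric.ball (0 : E2) R))).toReal) ^ 2
        * ∫ x in Metric.ball (0 : E2) R, g x * xbar η₀ x ^ a := by
  set F : E2 → ℝ := fun x => ‖u x‖ * xbar η₀ x ^ (-(a / 2)) with hF
  have cF : Continuous F := hu.norm.mul (continuous_xbar_rpow η₀ _)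
  set N := (eLpNorm F ⊤ (volume.restrict (Metric.ball (0 : E2) R))).toReal with hN
  have hfin : eLpNorm F ⊤ (volume.restrict (Metric.ball (0 : E2) R)) ≠ ⊤ := by
    obtain ⟨K, hK⟩ := (isCompact_closedBall (0 : E2) R).exists_bound_of_continuousOn cF.continuousOn
    refine (memLp_top_of_bound cF.aestronglyMeasurable K ?_).eLpNorm_ne_top
    filter_upwards [ae_restrict_mem Metric.isOpen_ball.measurableSet] with x hx
    exact hK x (Metric.ball_subset_closedBall hx)
  have hle : ∀ᵐ x ∂volume.restrict (Metric.ball (0 : E2) R), F x ≤ N := by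
    filter_upwards [ae_le_eLpNormEssSup (f := F)
      (μ := volume.restrict (Metric.ball (0 : E2) R))] with x hx
    rw [← eLpNorm_exponent_top] at hx
    have := ENNReal.toReal_mono hfin hx
    rw [toReal_enorm] at this
    exact (le_abs_self _).trans this
  rw [← integral_const_mul]
  refine integral_mono_ae (integrableOn_ball_of_continuous ((hu.norm.pow 2).mul hg) R)
    ((integrableOn_ball_of_continuous (hg.mul (continuous_xbar_rpow η₀ a)) R).const_mul _) ?_
  filter_upwards [hle] with x hx
  have hp := xbar_pos η₀ x
  have hF0 : 0 ≤ F x := mul_nonneg (norm_nonneg _) (Real.rpow_nonneg hp.le _)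
  have hu2 : ‖u x‖ ^ 2 = F x ^ 2 * xbar η₀ x ^ a := by
    have : (xbar η₀ x ^ (-(a / 2))) ^ 2 * xbar η₀ x ^ a = 1 := by
      rw [← Real.rpow_natCast, ← Real.rpow_mul hp.le, ← Real.rpow_add hp]
      norm_num
    rw [hF, mul_pow, mul_assoc, this, mul_one]
  have hsq : F x ^ 2 ≤ N ^ 2 := pow_le_pow_left₀ hF0 hx 2
  calc ‖u x‖ ^ 2 * g x = F x ^ 2 * (g x * xbar η₀ x ^ a) := by rw [hu2]; ring
    _ ≤ N ^ 2 * (g x * xbar η₀ x ^ a) :=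
        mul_le_mul_of_nonneg_right hsq (mul_nonneg (hg0 x) (Real.rpow_nonneg hp.le _))

lemma sum_sq_induction_le (ν D h₀ h₁ u₀ u₁ p₀₀ p₀₁ p₁₀ p₁₁ q₀₀ q₀₁ q₁₀ q₁₁ L₀ L₁ : ℝ)
    (hL₀ : L₀ ^ 2 ≤ 4 * D) (hL₁ : L₁ ^ 2 ≤ 4 * D) :
    (ν * L₀ + (h₀ * p₀₀ + h₁ * p₁₀) - (u₀ * q₀₀ + u₁ * q₁₀) - h₀ * (p₀₀ + p₁₁)) ^ 2
      + (ν * L₁ + (h₀ * p₀₁ + h₁ * p₁₁) - (u₀ * q₀₁ + u₁ * q₁₁) - h₁ * (p₀₀ + p₁₁)) ^ 2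
      ≤ 32 * ν ^ 2 * D
        + 4 * ((u₀ ^ 2 + u₁ ^ 2) * (q₀₀ ^ 2 + q₀₁ ^ 2 + (q₁₀ ^ 2 + q₁₁ ^ 2)))
        + 12 * ((h₀ ^ 2 + h₁ ^ 2) * (p₀₀ ^ 2 + p₀₁ ^ 2 + (p₁₀ ^ 2 + p₁₁ ^ 2))) := by
  have four : ∀ A B C E : ℝ, (A + B - C - E) ^ 2 ≤ 4 * (A ^ 2 + B ^ 2 + C ^ 2 + E ^ 2) := by
    intro A B C E
    nlinarith [sq_nonneg (A - B), sq_nonneg (A + C), sq_nonneg (A + E), sq_nonneg (B + C),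
      sq_nonneg (B + E), sq_nonneg (C - E)]
  have cs : ∀ a b c d : ℝ, (a * c + b * d) ^ 2 ≤ (a ^ 2 + b ^ 2) * (c ^ 2 + d ^ 2) := by
    intro a b c d
    nlinarith [sq_nonneg (a * d - b * c)]
  have hdiv : (p₀₀ + p₁₁) ^ 2 ≤ 2 * (p₀₀ ^ 2 + p₀₁ ^ 2 + (p₁₀ ^ 2 + p₁₁ ^ 2)) := by
    nlinarith [sq_nonneg (p₀₀ - p₁₁), sq_nonneg p₀₁, sq_nonneg p₁₀]
  have e₁ := mul_le_mul_of_nonneg_left (add_le_add hL₀ hL₁) (sq_nonneg ν)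
  have e₂ := mul_le_mul_of_nonneg_left hdiv (by positivity : 0 ≤ h₀ ^ 2 + h₁ ^ 2)
  linarith [four (ν * L₀) (h₀ * p₀₀ + h₁ * p₁₀) (u₀ * q₀₀ + u₁ * q₁₀) (h₀ * (p₀₀ + p₁₁)),
    four (ν * L₁) (h₀ * p₀₁ + h₁ * p₁₁) (u₀ * q₀₁ + u₁ * q₁₁) (h₁ * (p₀₀ + p₁₁)),
    cs h₀ h₁ p₀₀ p₁₀, cs h₀ h₁ p₀₁ p₁₁, cs u₀ u₁ q₀₀ q₁₀, cs u₀ u₁ q₀₁ q₁₁]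

lemma lapc_component_sq_le {v : E2 → E2} (hv : ContDiff ℝ (⊤ : ℕ∞) v) (j : Fin 2) (x : E2) :
    lapc (fun y => v y j) x ^ 2 ≤ 4 * ‖iteratedFDeriv ℝ 2 v x‖ ^ 2 := by
  have h0 := abs_le.1 (abs_iteratedFDeriv_two_single_le hv 0 j x)
  have h1 := abs_le.1 (abs_iteratedFDeriv_two_single_le hv 1 j x)
  unfold lapc
  rw [Fin.sum_univ_two, show (4 : ℝ) * ‖iteratedFDeriv ℝ 2 v x‖ ^ 2
    = (2 * ‖iteratedFDeriv ℝ 2 v x‖) ^ 2 by ring]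
  exact sq_le_sq' (by linarith) (by linarith)

lemma continuous_lapc_component {v : E2 → E2} (hv : ContDiff ℝ (⊤ : ℕ∞) v) (j : Fin 2) :
    Continuous (lapc fun y => v y j) := by
  have h : lapc (fun y => v y j) = fun x => ∑ i : Fin 2, pd i (pd i fun y => v y j) x := by
    funext x
    simp only [lapc, pd_pd_component hv]
  rw [h]
  exact continuous_finsetSum _ fun i _ =>
    (contDiff_pd (contDiff_pd (contDiff_component hv j) i) i).continuous

end helpers

/-- `L²` estimate for `H_t = νΔH + H·∇u − u·∇H − H div u`. -/
theorem stmt16 (ν a η₀ : ℝ) (hν : 0 < ν) (ha : 1 < a) (hη₀ : 0 < η₀) :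
    ∃ C : ℝ, 0 < C ∧ ∀ R : ℝ, 0 < R → ∀ H u : E2 → E2,
      ContDiff ℝ (⊤ : ℕ∞) H → ContDiff ℝ (⊤ : ℕ∞) u →
      (∀ x ∈ Metric.sphere (0 : E2) R, H x = 0 ∧ u x = 0) →
      (∀ x ∈ Metric.ball (0 : E2) R, divg H x = 0) →
      (∫ x in Metric.ball (0 : E2) R,
          ∑ j : Fin 2,
            (ν * lapc (fun y => H y j) x
              + (∑ i : Fin 2, H x i * pd i (fun y => u y j) x)
              - (∑ i : Fin 2, u x i * pd i (fun y => H y j) x)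
              - H x j * divg u x) ^ 2)
        ≤ C * ((∫ x in Metric.ball (0 : E2) R, ‖iteratedFDeriv ℝ 2 H x‖ ^ 2)
            + ((eLpNorm (fun x => ‖u x‖ * xbar η₀ x ^ (-(a / 2))) ⊤
                  (volume.restrict (Metric.ball (0 : E2) R))).toReal) ^ 2
              * (∫ x in Metric.ball (0 : E2) R, gradsq H x * xbar η₀ x ^ a)
            + (∫ x in Metric.ball (0 : E2) R, ‖H x‖ ^ 2) ^ ((1 : ℝ) / 2)
              * ((∫ x in Metric.ball (0 : E2) R, ‖H x‖ ^ 2)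
                  + (∫ x in Metric.ball (0 : E2) R, gradsq H x)) ^ ((1 : ℝ) / 2)
              * (∫ x in Metric.ball (0 : E2) R, gradsq u x) ^ ((1 : ℝ) / 2)
              * ((∫ x in Metric.ball (0 : E2) R, gradsq u x)
                  + (∫ x in Metric.ball (0 : E2) R,
                      ‖iteratedFDeriv ℝ 2 u x‖ ^ 2)) ^ ((1 : ℝ) / 2)) := by
  refine ⟨32 * ν ^ 2 + 4 + 384, by positivity, fun R hR H u hH hu h0 _ => ?_⟩
  have cH := continuous_pd_component hH
  have cu := continuous_pd_component hu
  have cHj : ∀ j, Continuous fun x => H x j := fun j => (contDiff_component hH j).continuous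
  have cuj : ∀ j, Continuous fun x => u x j := fun j => (contDiff_component hu j).continuous
  have cL := continuous_lapc_component hH
  have cdiv : Continuous (divg u) := continuous_finsetSum _ fun i _ => cu i i
  have cD := continuous_norm_iteratedFDeriv_two hH
  have cW : Continuous fun x => ‖u x‖ ^ 2 * gradsq H x :=
    (hu.continuous.norm.pow 2).mul (continuous_gradsq hH)
  have cS : Continuous fun x => ‖H x‖ ^ 2 * gradsq u x :=
    (hH.continuous.norm.pow 2).mul (continuous_gradsq hu)
  have hpoint : ∀ x, ∑ j : Fin 2,
      (ν * lapc (fun y => H y j) x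
        + (∑ i : Fin 2, H x i * pd i (fun y => u y j) x)
        - (∑ i : Fin 2, u x i * pd i (fun y => H y j) x)
        - H x j * divg u x) ^ 2
      ≤ 32 * ν ^ 2 * ‖iteratedFDeriv ℝ 2 H x‖ ^ 2 + 4 * (‖u x‖ ^ 2 * gradsq H x)
        + 12 * (‖H x‖ ^ 2 * gradsq u x) := by
    intro x
    simp only [EuclideanSpace.norm_sq_eq, gradsq, divg, Fin.sum_univ_two, Real.norm_eq_abs, sq_abs]
    exact sum_sq_induction_le _ _ _ _ _ _ _ _ _ _ _ _ _ _ _ _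
      (lapc_component_sq_le hH 0 x) (lapc_component_sq_le hH 1 x)
  have hI := integral_mono (μ := volume.restrict (Metric.ball (0 : E2) R))
    (integrableOn_ball_of_continuous (by fun_prop) R)
    (integrableOn_ball_of_continuous (by fun_prop) R) hpoint
  refine hI.trans ?_
  have i1 := (integrableOn_ball_of_continuous cD R).const_mul (32 * ν ^ 2)
  have i2 := (integrableOn_ball_of_continuous cW R).const_mul 4
  have i3 := (integrableOn_ball_of_continuous cS R).const_mul 12
  have i12 : Integrable (fun x => 32 * ν ^ 2 * ‖iteratedFDeriv ℝ 2 H x‖ ^ 2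
      + 4 * (‖u x‖ ^ 2 * gradsq H x)) (volume.restrict (Metric.ball (0 : E2) R)) := i1.add i2
  rw [integral_add i12 i3, integral_add i1 i2, integral_const_mul, integral_const_mul,
    integral_const_mul]
  have hW := integral_ball_norm_sq_mul_le_weighted a η₀ R hu.continuous (continuous_gradsq hH)
    (gradsq_nonneg H)
  have hS := integral_ball_norm_sq_mul_gradsq_le hR hH hu (fun x hx => (h0 x hx).1)
    (fun x hx => (h0 x hx).2)
  have nA : 0 ≤ ∫ x in Metric.ball (0 : E2) R, ‖H x‖ ^ 2 := integral_nonneg fun x => by positivity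
  have nG : 0 ≤ ∫ x in Metric.ball (0 : E2) R, gradsq H x := integral_nonneg (gradsq_nonneg H)
  have nP : 0 ≤ ∫ x in Metric.ball (0 : E2) R, gradsq u x := integral_nonneg (gradsq_nonneg u)
  have nQ : 0 ≤ ∫ x in Metric.ball (0 : E2) R, ‖iteratedFDeriv ℝ 2 u x‖ ^ 2 :=
    integral_nonneg fun x => by positivity
  have nD : 0 ≤ ∫ x in Metric.ball (0 : E2) R, ‖iteratedFDeriv ℝ 2 H x‖ ^ 2 :=
    integral_nonneg fun x => by positivity
  have nW : 0 ≤ ∫ x in Metric.ball (0 : E2) R, gradsq H x * xbar η₀ x ^ a :=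
    integral_nonneg fun x => mul_nonneg (gradsq_nonneg H x) (Real.rpow_nonneg (xbar_pos η₀ x).le _)
  generalize (∫ x in Metric.ball (0 : E2) R, ‖H x‖ ^ 2) = A at *
  generalize (∫ x in Metric.ball (0 : E2) R, gradsq H x) = G at *
  generalize (∫ x in Metric.ball (0 : E2) R, gradsq u x) = P at *
  generalize (∫ x in Metric.ball (0 : E2) R, ‖iteratedFDeriv ℝ 2 u x‖ ^ 2) = Q at *
  generalize (∫ x in Metric.ball (0 : E2) R, ‖iteratedFDeriv ℝ 2 H x‖ ^ 2) = D at *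
  have hX : A ^ ((1 : ℝ) / 2) * G ^ ((1 : ℝ) / 2) * P ^ ((1 : ℝ) / 2) * Q ^ ((1 : ℝ) / 2)
      ≤ A ^ ((1 : ℝ) / 2) * (A + G) ^ ((1 : ℝ) / 2) * P ^ ((1 : ℝ) / 2)
        * (P + Q) ^ ((1 : ℝ) / 2) := by
    gcongr <;> linarith
  have nX : 0 ≤ A ^ ((1 : ℝ) / 2) * (A + G) ^ ((1 : ℝ) / 2) * P ^ ((1 : ℝ) / 2)
        * (P + Q) ^ ((1 : ℝ) / 2) := by positivity
  have nW' := mul_nonneg (sq_nonneg (eLpNorm (fun x => ‖u x‖ * xbar η₀ x ^ (-(a / 2))) ⊤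
    (volume.restrict (Metric.ball (0 : E2) R))).toReal) nW
  have m1 := mul_nonneg (sq_nonneg ν) nX
  have m2 := mul_nonneg (sq_nonneg ν) nW'
  linarith
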